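/- Consider N+1 qubits labelled 0 (system) and 1,…,N (reservoir), initially in the pure state Ψ₀ = (α|0⟩ + β|1⟩) ⊗ |0⟩^{⊗N} with |α|²+|β|²=1. Let η ∈ ℝ, c = cos η, s = sin η, and let Ψ_n be the state obtained by applying the partial swap U_η = c·I + i s·S successively between qubit 0 and qubits 1,2,…,n (n ≤ N). Then the single-qubit reduced density matrices of |Ψ_n⟩⟨Ψ_n| satisfy: det ρ₀(n) = |β|⁴ c^{2n}(1 − c^{2n}) for the system qubit, and det ρ_j(n) = |β|⁴ s² c^{2(j−1)} (1 − s² c^{2(j−1)}) for each reservoir qubit 1 ≤ j ≤ n, while det ρ_j(n) = 0 for j > n. (Equivalently, the one-tangles are τ₀(n) = 4|β|⁴c^{2n}(1−c^{2n}) and τ_j(n) = 4|β|⁴s²c^{2(j−1)}(1−s²c^{2(j−1)}).) -/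

import Mathlib

open Matrix Complex BigOperators

noncomputable section

/-- The swap operator `S` on `ℂ² ⊗ ℂ²`. -/
def swapOp2 : Matrix (Fin 2 × Fin 2) (Fin 2 × Fin 2) ℂ :=
  Matrix.of fun p q => if p.1 = q.2 ∧ p.2 = q.1 then 1 else 0

/-- The partial swap `U_η = cos η · I + i sin η · S` on two qubits. -/
def pswap2 (η : ℝ) : Matrix (Fin 2 × Fin 2) (Fin 2 × Fin 2) ℂ :=
  (Real.cos η : ℂ) • 1 + (Complex.I * (Real.sin η : ℂ)) • swapOp2

/-- Apply a two-qubit gate `U` to qubits `0` and `i` of an `(N+1)`-qubit pure state,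
leaving the remaining qubits untouched. -/
def applyGate {N : ℕ} (U : Matrix (Fin 2 × Fin 2) (Fin 2 × Fin 2) ℂ) (i : Fin (N + 1))
    (Ψ : (Fin (N + 1) → Fin 2) → ℂ) : (Fin (N + 1) → Fin 2) → ℂ :=
  fun v => ∑ a : Fin 2, ∑ b : Fin 2,
    U (v 0, v i) (a, b) * Ψ (Function.update (Function.update v 0 a) i b)

/-- Extend a configuration of all qubits except `j` by the value `a` at qubit `j`. -/
def insertAt {M : ℕ} (j : Fin M) (a : Fin 2)
    (f : {k : Fin M // k ≠ j} → Fin 2) : Fin M → Fin 2 :=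
  fun k => if h : k = j then a else f ⟨k, h⟩

/-- The single-qubit reduced density matrix of the pure state `Ψ` on qubit `j`. -/
def rdm {M : ℕ} (Ψ : (Fin M → Fin 2) → ℂ) (j : Fin M) : Matrix (Fin 2) (Fin 2) ℂ :=
  Matrix.of fun a b =>
    ∑ f : {k : Fin M // k ≠ j} → Fin 2, Ψ (insertAt j a f) * star (Ψ (insertAt j b f))

/-- State with a vacuum amplitude `A` and one-excitation amplitudes `w`. -/
def oneExc {ι : Type} [Fintype ι] [DecidableEq ι] (A : ℂ) (w : ι → ℂ) (v : ι → Fin 2) : ℂ :=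
  (if v = 0 then A else 0) + ∑ k, if v = Pi.single k 1 then w k else 0

lemma single_inj_aux {ι : Type} [DecidableEq ι] (k l : ι) :
    (Pi.single k 1 : ι → Fin 2) = Pi.single l 1 ↔ k = l := by
  constructor
  · intro h
    by_contra hne
    have := congrFun h k
    simp [Pi.single_apply, hne] at this
  · rintro rfl; rfl

lemma single_ne_aux {ι : Type} [DecidableEq ι] (k : ι) :
    (Pi.single k 1 : ι → Fin 2) ≠ 0 := by
  intro h
  have := congrFun h k
  simp at this

lemma oneExc_zero {ι : Type} [Fintype ι] [DecidableEq ι] (A : ℂ) (w : ι → ℂ) :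
    oneExc A w 0 = A := by
  simp [oneExc, (single_ne_aux _).symm]

lemma oneExc_single {ι : Type} [Fintype ι] [DecidableEq ι] (A : ℂ) (w : ι → ℂ) (k : ι) :
    oneExc A w (Pi.single k 1) = w k := by
  simp [oneExc, single_ne_aux, single_inj_aux]

lemma oneExc_norm {ι : Type} [Fintype ι] [DecidableEq ι] (A : ℂ) (w : ι → ℂ) :
    ∑ f, oneExc A w f * star (oneExc A w f) = A * star A + ∑ k, w k * star (w k) := by
  have h : ∀ f, oneExc A w f * star (oneExc A w f) =
      (if f = 0 then oneExc A w f * star A else 0) +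
        ∑ k, if f = Pi.single k 1 then oneExc A w f * star (w k) else 0 := by
    intro f
    conv_lhs => rw [show star (oneExc A w f) = (if f = 0 then star A else 0) +
        ∑ k, if f = Pi.single k 1 then star (w k) else 0 by
          simp only [oneExc, star_add, star_sum, apply_ite star, star_zero]]
    simp only [mul_add, Finset.mul_sum, mul_ite, mul_zero]
  simp only [h, Finset.sum_add_distrib]
  rw [Finset.sum_comm]
  simp [oneExc_zero, oneExc_single]

lemma insertAt_zero_iff {M : ℕ} (j : Fin M) (f : {k : Fin M // k ≠ j} → Fin 2) :
    insertAt j 0 f = 0 ↔ f = 0 := by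
  constructor
  · intro h; ext ⟨k, hk⟩
    have := congrFun h k
    simp [insertAt, hk] at this
    simp [this]
  · rintro rfl; ext k; simp [insertAt]

lemma insertAt_one_ne {M : ℕ} (j : Fin M) (f : {k : Fin M // k ≠ j} → Fin 2) :
    insertAt j 1 f ≠ 0 := by
  intro h
  have := congrFun h j
  simp [insertAt] at this

lemma insertAt_one_single {M : ℕ} (j k : Fin M) (f : {k : Fin M // k ≠ j} → Fin 2) :
    insertAt j 1 f = Pi.single k 1 ↔ k = j ∧ f = 0 := by
  constructor
  · intro h
    have hj : k = j := by
      by_contra hne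
      have := congrFun h j
      simp [insertAt, Pi.single_apply, Ne.symm hne] at this
    subst hj
    refine ⟨rfl, ?_⟩
    ext ⟨l, hl⟩
    have := congrFun h l
    simp [insertAt, hl, Pi.single_apply] at this
    simp [this]
  · rintro ⟨rfl, rfl⟩
    ext l
    by_cases h : l = k <;> simp [insertAt, h, Pi.single_apply]

lemma insertAt_zero_self {M : ℕ} (j : Fin M) (f : {k : Fin M // k ≠ j} → Fin 2) :
    insertAt j 0 f ≠ Pi.single j 1 := by
  intro h
  have := congrFun h j
  simp [insertAt] at this

lemma insertAt_zero_single {M : ℕ} (j : Fin M) (k : {k : Fin M // k ≠ j})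
    (f : {k : Fin M // k ≠ j} → Fin 2) :
    insertAt j 0 f = Pi.single (k : Fin M) 1 ↔ f = Pi.single k 1 := by
  constructor
  · intro h
    ext ⟨l, hl⟩
    have := congrFun h l
    simp [insertAt, hl, Pi.single_apply] at this
    simp [this, Pi.single_apply, Subtype.ext_iff]
  · rintro rfl
    ext l
    by_cases h : l = j
    · subst h
      simp [insertAt, Pi.single_apply, Ne.symm k.2]
    · simp [insertAt, h, Pi.single_apply, Subtype.ext_iff]

lemma sum_split {M : ℕ} (j : Fin M) (g : Fin M → ℂ) :
    ∑ k, g k = g j + ∑ k : {k : Fin M // k ≠ j}, g k := by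
  rw [Fintype.sum_eq_add_sum_subtype_ne g j]

lemma oneExc_ins0 {M : ℕ} (A : ℂ) (w : Fin M → ℂ) (j : Fin M)
    (f : {k : Fin M // k ≠ j} → Fin 2) :
    oneExc A w (insertAt j 0 f) = oneExc A (fun k : {k : Fin M // k ≠ j} => w k) f := by
  unfold oneExc
  rw [sum_split j]
  simp only [insertAt_zero_iff, insertAt_zero_self, insertAt_zero_single, if_false, zero_add]

lemma oneExc_ins1 {M : ℕ} (A : ℂ) (w : Fin M → ℂ) (j : Fin M)
    (f : {k : Fin M // k ≠ j} → Fin 2) :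
    oneExc A w (insertAt j 1 f) = if f = 0 then w j else 0 := by
  unfold oneExc
  by_cases h : f = 0 <;> simp [insertAt_one_ne, insertAt_one_single, h]

lemma rdm_det {M : ℕ} (A : ℂ) (w : Fin M → ℂ) (j : Fin M) :
    (rdm (oneExc A w) j).det
      = ((‖w j‖ ^ 2 * (∑ k, ‖w k‖ ^ 2 - ‖w j‖ ^ 2) : ℝ) : ℂ) := by
  have hs : ∀ z : ℂ, ((‖z‖ : ℂ)) ^ 2 = z * star z := fun z => by
    rw [← Complex.ofReal_pow, ← Complex.normSq_eq_norm_sq]; exact (Complex.mul_conj z).symm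
  rw [Matrix.det_fin_two]
  simp only [rdm, Matrix.of_apply, oneExc_ins0, oneExc_ins1, oneExc_norm]
  push_cast
  simp only [hs]
  rw [sum_split j (fun k => w k * star (w k))]
  simp [oneExc_zero, apply_ite (starRingEnd ℂ)]
  ring

lemma applyGate_pswap {N : ℕ} (η : ℝ) (i : Fin (N + 1)) (hi : i ≠ 0)
    (Ψ : (Fin (N + 1) → Fin 2) → ℂ) (v : Fin (N + 1) → Fin 2) :
    applyGate (pswap2 η) i Ψ v = (Real.cos η : ℂ) * Ψ v
      + (Complex.I * (Real.sin η : ℂ)) * Ψ (v ∘ Equiv.swap 0 i) := by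
  have h1 : Function.update (Function.update v 0 (v 0)) i (v i) = v := by simp
  have h2 : Function.update (Function.update v 0 (v i)) i (v 0) = v ∘ Equiv.swap 0 i := by
    ext k
    by_cases hk : k = i
    · subst hk; simp
    · by_cases hk0 : k = 0
      · subst hk0; simp [Function.update_of_ne hk]
      · simp [Function.update_of_ne hk, Function.update_of_ne hk0,
          Equiv.swap_apply_of_ne_of_ne hk0 hk]
  have key : ∀ (x y : Fin 2) (g : Fin 2 → Fin 2 → ℂ),
      ∑ a : Fin 2, ∑ b : Fin 2, pswap2 η (x, y) (a, b) * g a b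
        = (Real.cos η : ℂ) * g x y + (Complex.I * (Real.sin η : ℂ)) * g y x := by
    intro x y g
    fin_cases x <;> fin_cases y <;>
      simp [pswap2, swapOp2, Fin.sum_univ_two, Matrix.one_apply] <;> ring
  unfold applyGate
  rw [key (v 0) (v i) (fun a b => Ψ (Function.update (Function.update v 0 a) i b)), h1, h2]

lemma oneExc_comp {ι : Type} [Fintype ι] [DecidableEq ι] (A : ℂ) (w : ι → ℂ)
    (σ : Equiv.Perm ι) (hσ : ∀ k, σ (σ k) = k) (v : ι → Fin 2) :
    oneExc A w (v ∘ σ) = oneExc A (w ∘ σ) v := by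
  have key : ∀ u : ι → Fin 2, v ∘ σ = u ↔ v = u ∘ σ := by
    intro u
    constructor
    · rintro rfl; ext k; simp [hσ]
    · rintro rfl; ext k; simp [hσ]
  have hsing : ∀ k, (Pi.single (σ k) 1 : ι → Fin 2) ∘ σ = Pi.single k 1 := by
    intro k; ext l; simp [Pi.single_apply]
  unfold oneExc
  rw [← Equiv.sum_comp σ]
  simp only [key, hsing]
  rfl

lemma oneExc_lin {ι : Type} [Fintype ι] [DecidableEq ι] (a b A B : ℂ) (w u : ι → ℂ)
    (v : ι → Fin 2) :
    a * oneExc A w v + b * oneExc B u v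
      = oneExc (a * A + b * B) (fun k => a * w k + b * u k) v := by
  unfold oneExc
  simp only [mul_add, Finset.mul_sum, mul_ite, mul_zero]
  rw [add_add_add_comm, ← Finset.sum_add_distrib]
  congr 1
  · split_ifs <;> simp
  · apply Finset.sum_congr rfl
    intro k _
    split_ifs <;> simp

lemma rot_norm (η : ℝ) (a b : ℂ) :
    ‖(Real.cos η : ℂ) * a + (Complex.I * (Real.sin η : ℂ)) * b‖ ^ 2
      + ‖(Real.cos η : ℂ) * b + (Complex.I * (Real.sin η : ℂ)) * a‖ ^ 2
      = ‖a‖ ^ 2 + ‖b‖ ^ 2 := by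
  simp only [← Complex.normSq_eq_norm_sq, Complex.normSq_apply, Complex.add_re, Complex.add_im,
    Complex.mul_re, Complex.mul_im, Complex.I_re, Complex.I_im, Complex.ofReal_re,
    Complex.ofReal_im]
  have := Real.sin_sq_add_cos_sq η
  linear_combination (a.re ^ 2 + a.im ^ 2 + b.re ^ 2 + b.im ^ 2) * this

lemma rot_sum {M : ℕ} (η : ℝ) (w : Fin M → ℂ) (σ : Equiv.Perm (Fin M))
    (hσ : ∀ k, σ (σ k) = k) :
    ∑ k, ‖(Real.cos η : ℂ) * w k + (Complex.I * (Real.sin η : ℂ)) * w (σ k)‖ ^ 2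
      = ∑ k, ‖w k‖ ^ 2 := by
  have h1 := Equiv.sum_comp σ
    (fun k => ‖(Real.cos η : ℂ) * w k + (Complex.I * (Real.sin η : ℂ)) * w (σ k)‖ ^ 2)
  have h2 := Equiv.sum_comp σ (fun k => ‖w k‖ ^ 2)
  have h3 : ∑ k, (‖(Real.cos η : ℂ) * w k + (Complex.I * (Real.sin η : ℂ)) * w (σ k)‖ ^ 2
      + ‖(Real.cos η : ℂ) * w (σ k) + (Complex.I * (Real.sin η : ℂ)) * w k‖ ^ 2)
      = ∑ k, (‖w k‖ ^ 2 + ‖w (σ k)‖ ^ 2) :=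
    Finset.sum_congr rfl fun k _ => rot_norm η _ _
  simp only [hσ] at h1
  simp only [Finset.sum_add_distrib] at h3
  linarith

lemma init_state {N : ℕ} (α β : ℂ) (v : Fin (N + 1) → Fin 2) :
    (if v 0 = 0 then α else β) * (if ∀ k, k ≠ 0 → v k = 0 then 1 else 0)
      = oneExc α (fun k => if k = 0 then β else 0) v := by
  have hv : v = insertAt 0 (v 0) (fun k => v k) := by
    ext k
    by_cases h : k = 0 <;> simp [insertAt, h]
  have hall : (∀ k, k ≠ 0 → v k = 0) ↔
      (fun k : {k : Fin (N + 1) // k ≠ 0} => v k) = 0 := by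
    constructor
    · intro h; ext k; simp [h k.1 k.2]
    · intro h k hk; exact congrFun h ⟨k, hk⟩
  have h01 : v 0 = 0 ∨ v 0 = 1 := by
    generalize v 0 = x
    fin_cases x <;> simp
  rcases h01 with h | h
  · rw [h] at hv
    conv_rhs => rw [hv, oneExc_ins0]
    simp only [hall, h, oneExc]
    have : ∀ k : {k : Fin (N + 1) // k ≠ 0}, (k : Fin (N+1)) ≠ 0 := fun k => k.2
    simp [this]
  · rw [h] at hv
    conv_rhs => rw [hv, oneExc_ins1]
    simp only [hall, h]
    simp

/-- One-tangles in the partial swap collision model: with `Ψ_n` obtained from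
`(α|0⟩+β|1⟩) ⊗ |0⟩^{⊗N}` by partial swap collisions of qubit `0` with qubits `1,…,n`,
`det ρ₀(n) = |β|⁴ c^{2n}(1 − c^{2n})`,
`det ρ_j(n) = |β|⁴ s² c^{2(j−1)}(1 − s² c^{2(j−1)})` for `1 ≤ j ≤ n`, and
`det ρ_j(n) = 0` for `j > n`. -/
theorem stmt14 {N : ℕ} (η : ℝ) (α β : ℂ) (hnorm : ‖α‖ ^ 2 + ‖β‖ ^ 2 = 1)
    (Ψseq : ℕ → ((Fin (N + 1) → Fin 2) → ℂ))
    (hΨ0 : Ψseq 0 = fun v => (if v 0 = 0 then α else β)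
      * (if ∀ k, k ≠ 0 → v k = 0 then 1 else 0))
    (hstep : ∀ (k : ℕ) (h : k + 1 ≤ N),
      Ψseq (k + 1)
        = applyGate (pswap2 η) (⟨k + 1, Nat.lt_succ_of_le h⟩ : Fin (N + 1)) (Ψseq k))
    (n : ℕ) (hn : n ≤ N) :
    (rdm (Ψseq n) 0).det
        = ((‖β‖ ^ 4 * Real.cos η ^ (2 * n) * (1 - Real.cos η ^ (2 * n)) : ℝ) : ℂ) ∧
    (∀ j : Fin (N + 1), 1 ≤ (j : ℕ) → (j : ℕ) ≤ n →
      (rdm (Ψseq n) j).det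
        = ((‖β‖ ^ 4 * Real.sin η ^ 2 * Real.cos η ^ (2 * ((j : ℕ) - 1))
            * (1 - Real.sin η ^ 2 * Real.cos η ^ (2 * ((j : ℕ) - 1))) : ℝ) : ℂ)) ∧
    (∀ j : Fin (N + 1), n < (j : ℕ) → (rdm (Ψseq n) j).det = 0) := by
  have inv : ∀ n : ℕ, n ≤ N → ∃ (A : ℂ) (w : Fin (N + 1) → ℂ), Ψseq n = oneExc A w ∧
      w 0 = β * (Real.cos η : ℂ) ^ n ∧ ∑ k, ‖w k‖ ^ 2 = ‖β‖ ^ 2 ∧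
      (∀ j : Fin (N + 1), n < (j : ℕ) → w j = 0) ∧
      (∀ j : Fin (N + 1), 1 ≤ (j : ℕ) → (j : ℕ) ≤ n →
        ‖w j‖ ^ 2 = ‖β‖ ^ 2 * (Real.sin η ^ 2 * Real.cos η ^ (2 * ((j : ℕ) - 1)))) := by
    intro n
    induction n with
    | zero =>
      intro _
      refine ⟨α, fun k => if k = 0 then β else 0, ?_, by simp, ?_, ?_, ?_⟩
      · rw [hΨ0]; funext v; exact init_state α β v
      · simp [apply_ite]
      · intro j hj
        have : j ≠ 0 := by rintro rfl; simp at hj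
        simp [this]
      · intro j h1 h2; omega
    | succ n ih =>
      intro hn
      obtain ⟨A, w, hΨ, h0, hsum, hgt, hle⟩ := ih (by omega)
      set i : Fin (N + 1) := ⟨n + 1, Nat.lt_succ_of_le hn⟩ with hi
      have hine : i ≠ 0 := by
        intro h; have := congrArg Fin.val h; simp [hi] at this
      have hwi : w i = 0 := hgt i (by simp [hi])
      have hinv : ∀ k, Equiv.swap 0 i (Equiv.swap 0 i k) = k := fun k => by simp
      refine ⟨(Real.cos η : ℂ) * A + (Complex.I * (Real.sin η : ℂ)) * A, fun k => (Real.cos η : ℂ) * w k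
        + (Complex.I * (Real.sin η : ℂ)) * (w ∘ Equiv.swap 0 i) k, ?_, ?_, ?_, ?_, ?_⟩
      · rw [hstep n hn, hΨ]
        funext v
        rw [applyGate_pswap η i hine, oneExc_comp _ _ _ hinv, oneExc_lin]
      · simp only [Function.comp, Equiv.swap_apply_left, hwi, h0]; ring
      · rw [← hsum]; exact rot_sum η w _ hinv
      · intro j hj
        have hj0 : j ≠ 0 := by rintro rfl; simp at hj
        have hji : j ≠ i := by rintro rfl; simp [hi] at hj
        simp only [Function.comp, Equiv.swap_apply_of_ne_of_ne hj0 hji, hgt j (by omega)]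
        simp
      · intro j h1 h2
        have hj0 : j ≠ 0 := by rintro rfl; simp at h1
        by_cases hji : j = i
        · subst hji
          simp only [Function.comp, Equiv.swap_apply_right, hwi, h0]
          simp only [mul_zero, zero_add, norm_mul, norm_pow, Complex.norm_I, Complex.norm_real,
            Real.norm_eq_abs, mul_pow, sq_abs, one_pow, one_mul, hi, Nat.add_sub_cancel]
          rw [← pow_mul, mul_comm n 2, pow_mul |Real.cos η|, sq_abs, ← pow_mul]
          ring
        · have hjn : (j : ℕ) ≤ n := by
            have : (j : ℕ) ≠ n + 1 := fun h => hji (Fin.ext h)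
            omega
          rw [← hle j h1 hjn]
          simp only [Function.comp, Equiv.swap_apply_of_ne_of_ne hj0 hji]
          rw [← add_mul, norm_mul, mul_pow]
          have : ‖(Real.cos η : ℂ) + Complex.I * (Real.sin η : ℂ)‖ ^ 2 = 1 := by
            rw [← Complex.normSq_eq_norm_sq, Complex.normSq_apply]
            simp only [Complex.add_re, Complex.add_im,
              Complex.mul_re, Complex.mul_im, Complex.I_re, Complex.I_im, Complex.ofReal_re,
              Complex.ofReal_im]
            linear_combination Real.sin_sq_add_cos_sq η
          rw [this, one_mul]
  obtain ⟨A, w, hΨ, h0, hsum, hgt, hle⟩ := inv n hn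
  rw [hΨ]
  refine ⟨?_, ?_, ?_⟩
  · rw [rdm_det, hsum]
    have : ‖w 0‖ ^ 2 = ‖β‖ ^ 2 * Real.cos η ^ (2 * n) := by
      rw [h0, norm_mul, norm_pow, Complex.norm_real, Real.norm_eq_abs, mul_pow, ← pow_mul,
        mul_comm n 2, pow_mul |Real.cos η|, sq_abs, ← pow_mul]
    rw [this]
    congr 1
    ring
  · intro j h1 h2
    rw [rdm_det, hsum, hle j h1 h2]
    congr 1
    ring
  · intro j hj
    rw [rdm_det, hgt j hj]
    simp
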